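/- (Saltman: counter-example to the Noether problem over ℂ.) There exist a natural number n and a finite subgroup G of GL_n(ℂ), acting on the rational function field ℂ(x₁,…,xₙ) through its linear action on the variables, such that the fixed field ℂ(x₁,…,xₙ)^G is not stably rational over ℂ; in particular it is not purely transcendental over ℂ. -/

import Mathlib

open MvPolynomial

/-- The rational function field `ℂ(t₁,…,tₘ)`, realized as the field of fractions of the
polynomial ring over `ℂ` in `m` variables. -/
abbrev CRatFunc (m : ℕ) : Type := FractionRing (MvPolynomial (Fin m) ℂ)

/-- A `ℂ`-algebra `K` is purely transcendental over `ℂ` if it is isomorphic as a `ℂ`-algebra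
to `ℂ(t₁,…,tₘ)` for some `m ≥ 0`. -/
def IsPurelyTranscendental (K : Type*) [CommRing K] [Algebra ℂ K] : Prop :=
  ∃ m : ℕ, Nonempty (K ≃ₐ[ℂ] CRatFunc m)

/-- A `ℂ`-algebra `K` is unirational over `ℂ` if it admits a `ℂ`-algebra embedding into
`ℂ(t₁,…,tₘ)` for some `m`. -/
def IsUnirational (K : Type*) [CommRing K] [Algebra ℂ K] : Prop :=
  ∃ (m : ℕ) (f : K →ₐ[ℂ] CRatFunc m), Function.Injective f

/-- A field `K` over `ℂ` is stably rational over `ℂ` if `K(u₁,…,uₙ)` is purely transcendental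
over `ℂ` for some `n ≥ 0`. -/
def IsStablyRational (K : Type*) [Field K] [Algebra ℂ K] : Prop :=
  ∃ n : ℕ, IsPurelyTranscendental (FractionRing (MvPolynomial (Fin n) K))

/-- Dehomogenization at `X₀ = 1`: the image of `F ∈ ℂ[X₀,…,Xₙ]` under `X₀ ↦ 1`,
`X_{i+1} ↦ xᵢ`. -/
noncomputable def dehom {n : ℕ} (F : MvPolynomial (Fin (n + 1)) ℂ) : MvPolynomial (Fin n) ℂ :=
  aeval (Fin.cases 1 X) F


/-- conic has a point -/
def Spl {R : Type*} [CommRing R] (b c : R) : Prop :=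
  ∃ X Y Z : R, (X ≠ 0 ∨ Y ≠ 0 ∨ Z ≠ 0) ∧ X ^ 2 = b * Y ^ 2 + c * Z ^ 2

def PP (R : Type*) [CommRing R] : Prop :=
  ∀ b c x y : R, b ≠ 0 → c ≠ 0 → x ≠ 0 → y ≠ 0 →
    Spl b x → Spl x y → Spl b (y * c) → Spl (b * x) c → Spl b c

theorem Spl.symm {R : Type*} [CommRing R] {b c : R} (h : Spl b c) : Spl c b := by
  obtain ⟨X, Y, Z, h0, h⟩ := h
  exact ⟨X, Z, Y, by tauto, by rw [h]; ring⟩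

theorem Spl.mul {R : Type*} [CommRing R] [IsDomain R] {b c d : R} (h : Spl b c) (h' : Spl b d) :
    Spl b (c * d) := by
  obtain ⟨X, Y, Z, h0, h⟩ := h
  obtain ⟨X', Y', Z', h0', h'⟩ := h'
  by_cases hZ : Z = 0
  · subst hZ
    exact ⟨X, Y, 0, h0, by rw [h]; ring⟩
  by_cases hZ' : Z' = 0
  · subst hZ'
    exact ⟨X', Y', 0, h0', by rw [h']; ring⟩
  refine ⟨X * X' + b * Y * Y', X * Y' + X' * Y, Z * Z', Or.inr (Or.inr (mul_ne_zero hZ hZ')), ?_⟩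
  linear_combination (X' ^ 2 - b * Y' ^ 2) * h + (c * Z ^ 2) * h'

theorem Spl.of_sq {R : Type*} [CommRing R] [IsDomain R] {b c d : R} (hd : d ≠ 0)
    (h : Spl b (c * d ^ 2)) : Spl b c := by
  obtain ⟨X, Y, Z, h0, h⟩ := h
  refine ⟨X, Y, d * Z, ?_, by rw [h]; ring⟩
  rcases h0 with h0 | h0 | h0
  · exact Or.inl h0
  · exact Or.inr (Or.inl h0)
  · exact Or.inr (Or.inr (mul_ne_zero hd h0))

theorem Spl.to_sq {R : Type*} [CommRing R] [IsDomain R] {b c d : R} (hd : d ≠ 0)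
    (h : Spl b c) : Spl b (c * d ^ 2) := by
  obtain ⟨X, Y, Z, h0, h⟩ := h
  refine ⟨d * X, d * Y, Z, ?_, by linear_combination d ^ 2 * h⟩
  rcases h0 with h0 | h0 | h0
  · exact Or.inl (mul_ne_zero hd h0)
  · exact Or.inr (Or.inl (mul_ne_zero hd h0))
  · exact Or.inr (Or.inr h0)

theorem Spl.map {R S : Type*} [CommRing R] [CommRing S] (f : R →+* S)
    (hf : Function.Injective f) {b c : R} (h : Spl b c) : Spl (f b) (f c) := by
  obtain ⟨X, Y, Z, h0, h⟩ := h
  refine ⟨f X, f Y, f Z, ?_, by simp only [← map_pow, ← map_mul, ← map_add, h]⟩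
  simpa only [ne_eq, map_eq_zero_iff f hf] using h0

theorem Spl.unmap {R S : Type*} [CommRing R] [IsDomain R] [CommRing S] [IsDomain S] [Algebra R S]
    (M : Submonoid R) [IsLocalization M S] (hM : M ≤ nonZeroDivisors R) {b c : R}
    (h : Spl (algebraMap R S b) (algebraMap R S c)) : Spl b c := by
  obtain ⟨X, Y, Z, h0, h⟩ := h
  have hinj := IsLocalization.injective S hM
  classical
  obtain ⟨d, hd⟩ := IsLocalization.exist_integer_multiples_of_finset M ({X, Y, Z} : Finset S)
  obtain ⟨X', hX⟩ := hd X (by simp)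
  obtain ⟨Y', hY⟩ := hd Y (by simp)
  obtain ⟨Z', hZ⟩ := hd Z (by simp)
  have hd0 : algebraMap R S (d : R) ≠ 0 := by
    rw [Ne, map_eq_zero_iff _ hinj]
    exact nonZeroDivisors.ne_zero (hM d.2)
  rw [Algebra.smul_def] at hX hY hZ
  refine ⟨X', Y', Z', ?_, ?_⟩
  · have key : ∀ (W : S) (W' : R), algebraMap R S W' = algebraMap R S d * W → W ≠ 0 → W' ≠ 0 := by
      intro W W' e hW hW'
      rw [hW', map_zero] at e
      exact mul_ne_zero hd0 hW e.symm
    rcases h0 with h0 | h0 | h0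
    · exact Or.inl (key _ _ hX h0)
    · exact Or.inr (Or.inl (key _ _ hY h0))
    · exact Or.inr (Or.inr (key _ _ hZ h0))
  · apply hinj
    simp only [map_pow, map_mul, map_add, hX, hY, hZ]
    linear_combination (algebraMap R S d) ^ 2 * h

theorem PP.of_equiv {R S : Type*} [CommRing R] [CommRing S] (e : R ≃+* S) (h : PP R) : PP S := by
  intro b c x y hb hc hx hy h1 h2 h3 h4
  have e0 : ∀ s : S, s ≠ 0 → e.symm s ≠ 0 := fun s hs => by simpa using hs
  have h3' := h3.map e.symm.toRingHom e.symm.injective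
  have h4' := h4.map e.symm.toRingHom e.symm.injective
  rw [map_mul] at h3' h4'
  have := h _ _ _ _ (e0 b hb) (e0 c hc) (e0 x hx) (e0 y hy)
    (h1.map e.symm.toRingHom e.symm.injective) (h2.map e.symm.toRingHom e.symm.injective)
    h3' h4'
  simpa using this.map e.toRingHom e.injective

/-- descends along injective localization -/
theorem PP.of_loc {R S : Type*} [CommRing R] [IsDomain R] [CommRing S] [IsDomain S] [Algebra R S]
    (M : Submonoid R) [IsLocalization M S] (hM : M ≤ nonZeroDivisors R) (h : PP S) : PP R := by
  intro b c x y hb hc hx hy h1 h2 h3 h4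
  have hinj := IsLocalization.injective S hM
  have e0 : ∀ s : R, s ≠ 0 → algebraMap R S s ≠ 0 := fun s hs => by
    rwa [Ne, map_eq_zero_iff _ hinj]
  have h3' := h3.map _ hinj
  have h4' := h4.map _ hinj
  rw [map_mul] at h3' h4'
  exact Spl.unmap M hM (h _ _ _ _ (e0 b hb) (e0 c hc) (e0 x hx) (e0 y hy) (h1.map _ hinj)
    (h2.map _ hinj) h3' h4')

theorem PP.to_frac {R S : Type*} [CommRing R] [IsDomain R] [Field S] [Algebra R S]
    [IsFractionRing R S] (h : PP R) : PP S := by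
  intro b c x y hb hc hx hy h1 h2 h3 h4
  have hinj := IsFractionRing.injective R S
  have key : ∀ s : S, s ≠ 0 → ∃ (r : R) (d : S), r ≠ 0 ∧ d ≠ 0 ∧ algebraMap R S r = s * d ^ 2 := by
    intro s hs
    obtain ⟨p, q, hq, rfl⟩ := IsFractionRing.div_surjective (A := R) s
    have hq0 : algebraMap R S q ≠ 0 := by
      rw [Ne, map_eq_zero_iff _ hinj]; exact nonZeroDivisors.ne_zero hq
    refine ⟨p * q, algebraMap R S q, ?_, hq0, ?_⟩
    · intro h0
      rcases mul_eq_zero.1 h0 with h0 | h0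
      · simp [h0] at hs
      · exact hq0 (by simp [h0])
    · rw [map_mul]; field_simp
  obtain ⟨b', d1, hb', hd1, e1⟩ := key b hb
  obtain ⟨c', d2, hc', hd2, e2⟩ := key c hc
  obtain ⟨x', d3, hx', hd3, e3⟩ := key x hx
  obtain ⟨y', d4, hy', hd4, e4⟩ := key y hy
  have toR : ∀ (p q : S) (p' q' : R) (d e : S), d ≠ 0 → e ≠ 0 → algebraMap R S p' = p * d ^ 2 →
      algebraMap R S q' = q * e ^ 2 → (Spl p q → Spl p' q') := by
    intro p q p' q' d e hd he hp hq h
    apply Spl.unmap (S := S) (nonZeroDivisors R) le_rfl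
    rw [hp, hq]
    exact ((h.to_sq he).symm.to_sq hd).symm
  have h1' := toR _ _ _ _ _ _ hd1 hd3 e1 e3 h1
  have h2' := toR _ _ _ _ _ _ hd3 hd4 e3 e4 h2
  have h3' := toR _ _ _ (y' * c') _ (d4 * d2) hd1 (mul_ne_zero hd4 hd2) e1
    (by rw [map_mul, e4, e2]; ring) h3
  have h4' := toR _ _ (b' * x') _ (d1 * d3) _ (mul_ne_zero hd1 hd3) hd2
    (by rw [map_mul, e1, e3]; ring) e2 h4
  have := (h _ _ _ _ hb' hc' hx' hy' h1' h2' h3' h4').map _ hinj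
  rw [e1, e2] at this
  exact (this.of_sq hd2).symm.of_sq hd1 |>.symm

section BB
open Polynomial

section Faddeev
variable {k : Type*} [Field k]

/-- `a` is a square modulo `p`. -/
def SqMod (p a : k[X]) : Prop := ∃ s, p ∣ s ^ 2 - a

theorem SqMod.mul {p a b : k[X]} (h : SqMod p a) (h' : SqMod p b) : SqMod p (a * b) := by
  obtain ⟨s, u, hs⟩ := h
  obtain ⟨r, v, hr⟩ := h'
  exact ⟨s * r, u * r ^ 2 + a * v, by linear_combination r ^ 2 * hs + a * hr⟩

theorem SqMod.sq (p a : k[X]) : SqMod p (a ^ 2) := ⟨a, by simp⟩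

theorem SqMod.cancel {p a b : k[X]} (hp : Irreducible p) (ha : ¬ p ∣ a) (h : SqMod p a)
    (h' : SqMod p (a * b)) : SqMod p b := by
  obtain ⟨s, u, hs⟩ := h
  obtain ⟨r, v, hr⟩ := h'
  have hps : ¬ p ∣ s := by
    rintro ⟨w, rfl⟩
    exact ha ⟨p * w ^ 2 - u, by linear_combination (-1 : k[X]) * hs⟩
  obtain ⟨e, f, hef⟩ := (Irreducible.coprime_iff_not_dvd hp).2 hps
  refine ⟨r * f, ?_⟩
  -- (r f)^2 - b
  refine ⟨v * f ^ 2 - b * f ^ 2 * u + b * (- e) * (1 + f * s), ?_⟩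
  linear_combination f ^ 2 * hr - b * f ^ 2 * hs + b * (f * s + 1) * hef

theorem SqMod.cancel_sq {p a b : k[X]} (hp : Irreducible p) (ha : ¬ p ∣ a)
    (h' : SqMod p (a ^ 2 * b)) : SqMod p b :=
  SqMod.cancel hp (fun h => ha (hp.prime.dvd_of_dvd_pow h)) (SqMod.sq p a) h'

/-- residue of the symbol `(f,g)` at `p` is trivial -/
def Unr (p f g : k[X]) : Prop :=
  ∀ (m n : ℕ) (u w : k[X]), f = p ^ m * u → g = p ^ n * w → ¬ p ∣ u → ¬ p ∣ w →
    SqMod p (u ^ n * w ^ m)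

theorem Unr.symm {p f g : k[X]} (h : Unr p f g) : Unr p g f := by
  intro m n u w hf hg hu hw
  have := h n m w u hg hf hw hu
  rwa [mul_comm]

theorem decomp {p f : k[X]} (hp : Irreducible p) (hf : f ≠ 0) :
    ∃ (m : ℕ) (u : k[X]), f = p ^ m * u ∧ ¬ p ∣ u := by
  obtain ⟨u, hu⟩ := (FiniteMultiplicity.of_prime_left hp.prime hf).exists_eq_pow_mul_and_not_dvd
  exact ⟨_, u, hu⟩

theorem Unr.trans {p b c c' : k[X]} (hp : Irreducible p) (hc : c ≠ 0)
    (h : Unr p b c) (h' : Unr p b (c * c')) : Unr p b c' := by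
  intro m n u w hf hg hu hw
  obtain ⟨n', w', hc', hw'⟩ := decomp hp hc
  have h1 := h m n' u w' hf hc' hu hw'
  have h2 := h' m (n' + n) u (w' * w) hf (by rw [hc', hg]; ring) hu
    (fun hh => (hp.prime.dvd_or_dvd hh).elim hw' hw)
  refine SqMod.cancel hp ?_ h1 (b := u ^ n * w ^ m) ?_
  · intro hh
    rcases hp.prime.dvd_or_dvd hh with hh | hh
    · exact hu (hp.prime.dvd_of_dvd_pow hh)
    · exact hw' (hp.prime.dvd_of_dvd_pow hh)
  · convert h2 using 1
    ring

theorem prim_sol {p b c : k[X]} (hp : Irreducible p) (h : Spl b c) :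
    ∃ X Y Z : k[X], ¬ (p ∣ X ∧ p ∣ Y ∧ p ∣ Z) ∧ X ^ 2 = b * Y ^ 2 + c * Z ^ 2 := by
  obtain ⟨X, Y, Z, h0, h⟩ := h
  generalize hN : X.natDegree + Y.natDegree + Z.natDegree = N
  induction N using Nat.strong_induction_on generalizing X Y Z with
  | _ N ih =>
  by_cases hd : p ∣ X ∧ p ∣ Y ∧ p ∣ Z
  · obtain ⟨⟨X', rfl⟩, ⟨Y', rfl⟩, ⟨Z', rfl⟩⟩ := hd
    have hp0 := hp.ne_zero
    have hpd : 0 < p.natDegree := hp.natDegree_pos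
    have h0' : X' ≠ 0 ∨ Y' ≠ 0 ∨ Z' ≠ 0 := by
      by_contra! hh
      obtain ⟨rfl, rfl, rfl⟩ := hh
      simp at h0
    have le : ∀ W : k[X], W.natDegree ≤ (p * W).natDegree := by
      intro W
      by_cases hW : W = 0
      · simp [hW]
      · rw [natDegree_mul hp0 hW]; omega
    have lt : ∀ W : k[X], W ≠ 0 → W.natDegree < (p * W).natDegree := by
      intro W hW
      rw [natDegree_mul hp0 hW]; omega
    refine ih _ ?_ X' Y' Z' h0' ?_ rfl
    · have := le X'; have := le Y'; have := le Z'
      rcases h0' with h1 | h1 | h1 <;> have := lt _ h1 <;> omega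
    · apply mul_left_cancel₀ (pow_ne_zero 2 hp0)
      linear_combination h
  · exact ⟨X, Y, Z, hd, h⟩

theorem sq_of_spl01 {p u w : k[X]} (hp : Irreducible p) (hw : ¬ p ∣ w)
    (h : Spl u (p * w)) : SqMod p u := by
  obtain ⟨X, Y, Z, hd, h⟩ := prim_sol hp h
  by_cases hY : p ∣ Y
  · exfalso
    have hX : p ∣ X := by
      apply hp.prime.dvd_of_dvd_pow (n := 2)
      obtain ⟨Y', rfl⟩ := hY
      exact ⟨u * p * Y' ^ 2 + w * Z ^ 2, by rw [h]; ring⟩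
    apply hd
    refine ⟨hX, hY, ?_⟩
    obtain ⟨Y', rfl⟩ := hY
    obtain ⟨X', rfl⟩ := hX
    have : p ∣ w * Z ^ 2 := by
      refine ⟨X' ^ 2 - u * Y' ^ 2, mul_left_cancel₀ hp.ne_zero ?_⟩
      linear_combination (-1 : k[X]) * h
    exact hp.prime.dvd_of_dvd_pow ((hp.prime.dvd_or_dvd this).resolve_left hw)
  · apply SqMod.cancel_sq hp hY
    exact ⟨X, w * Z ^ 2, by rw [h]; ring⟩

theorem sq_of_spl11 {p u w : k[X]} (hi : ∃ i : k, i ^ 2 = -1) (hp : Irreducible p)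
    (hw : ¬ p ∣ w) (h : Spl (p * u) (p * w)) : SqMod p (u * w) := by
  obtain ⟨i, hi⟩ := hi
  have hi : (Polynomial.C i : k[X]) ^ 2 = -1 := by rw [← Polynomial.C_pow, hi]; simp
  obtain ⟨X, Y, Z, hd, h⟩ := prim_sol hp h
  have hX : p ∣ X := by
    apply hp.prime.dvd_of_dvd_pow (n := 2)
    exact ⟨u * Y ^ 2 + w * Z ^ 2, by rw [h]; ring⟩
  obtain ⟨X', rfl⟩ := hX
  have h2 : p * X' ^ 2 = u * Y ^ 2 + w * Z ^ 2 := by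
    apply mul_left_cancel₀ hp.ne_zero
    linear_combination h
  by_cases hY : p ∣ Y
  · exfalso
    apply hd
    refine ⟨⟨X', rfl⟩, hY, ?_⟩
    obtain ⟨Y', rfl⟩ := hY
    have : p ∣ w * Z ^ 2 := ⟨X' ^ 2 - u * p * Y' ^ 2, by linear_combination (-1 : k[X]) * h2⟩
    exact hp.prime.dvd_of_dvd_pow ((hp.prime.dvd_or_dvd this).resolve_left hw)
  · apply SqMod.cancel_sq hp hY
    exact ⟨Polynomial.C i * w * Z, - w * X' ^ 2, by linear_combination w ^ 2 * Z ^ 2 * hi + w * h2⟩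

theorem Spl.unr {p b c : k[X]} (hi : ∃ i : k, i ^ 2 = -1) (hp : Irreducible p)
    (h : Spl b c) : Unr p b c := by
  intro m n u w hb hc hu hw
  have hp0 := hp.ne_zero
  subst hb hc
  obtain ⟨m', rfl | rfl⟩ := Nat.even_or_odd' m <;> obtain ⟨n', rfl | rfl⟩ := Nat.even_or_odd' n
  · convert SqMod.sq p (u ^ n' * w ^ m') using 1
    ring
  · have h1 : Spl u (p * w) := by
      refine (Spl.of_sq (d := p ^ m') (pow_ne_zero _ hp0)
        (Spl.of_sq (d := p ^ n') (pow_ne_zero _ hp0) (b := u * (p ^ m') ^ 2) ?_).symm).symm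
      convert h using 1 <;> ring
    convert (sq_of_spl01 hp hw h1).mul (SqMod.sq p (u ^ n' * w ^ m')) using 1
    ring
  · have h1 : Spl (p * u) w := by
      refine (Spl.of_sq (d := p ^ m') (pow_ne_zero _ hp0)
        (Spl.of_sq (d := p ^ n') (pow_ne_zero _ hp0) (b := p * u * (p ^ m') ^ 2) ?_).symm).symm
      convert h using 1 <;> ring
    convert (sq_of_spl01 hp hu h1.symm).mul (SqMod.sq p (u ^ n' * w ^ m')) using 1
    ring
  · have h1 : Spl (p * u) (p * w) := by
      refine (Spl.of_sq (d := p ^ m') (pow_ne_zero _ hp0)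
        (Spl.of_sq (d := p ^ n') (pow_ne_zero _ hp0) (b := p * u * (p ^ m') ^ 2) ?_).symm).symm
      convert h using 1 <;> ring
    convert (sq_of_spl11 hi hp hw h1).mul (SqMod.sq p (u ^ n' * w ^ m')) using 1
    ring

theorem sq_mod_sqfree {b : k[X]} (c : k[X]) (hc : Squarefree c) (hc0 : c ≠ 0)
    (h : ∀ p, Irreducible p → p ∣ c → SqMod p b) : SqMod c b := by
  induction c using UniqueFactorizationMonoid.induction_on_prime with
  | h₁ => exact absurd rfl hc0
  | h₂ x hx => exact ⟨0, hx.dvd⟩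
  | h₃ a p ha hp ih =>
    obtain ⟨r, u, hr⟩ := ih (hc.squarefree_of_dvd ⟨p, mul_comm _ _⟩) ha
      (fun q hq hqa => h q hq (hqa.mul_left _))
    obtain ⟨s, v, hs⟩ := h p hp.irreducible ⟨a, rfl⟩
    have hpa : ¬ p ∣ a := by
      rintro ⟨d, rfl⟩
      exact hp.not_isUnit (hc p ⟨d, by ring⟩)
    obtain ⟨e, f, hef⟩ := (Irreducible.coprime_iff_not_dvd hp.irreducible).2 hpa
    refine ⟨r * e * p + s * f * a, ?_⟩
    apply IsCoprime.mul_dvd ⟨e, f, hef⟩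
    · refine ⟨v + r ^ 2 * e ^ 2 * p + 2 * r * e * s * f * a - s ^ 2 * e * (1 + f * a), ?_⟩
      linear_combination hs + s ^ 2 * (f * a + 1) * hef
    · refine ⟨u + s ^ 2 * f ^ 2 * a + 2 * r * e * s * f * p - r ^ 2 * f * (1 + e * p), ?_⟩
      linear_combination hr + r ^ 2 * (e * p + 1) * hef

theorem ev_ne [Infinite k] {f : k[X]} (hf : f ≠ 0) : ∀ᶠ t in Filter.cofinite, f.eval t ≠ 0 := by
  rw [Filter.eventually_cofinite]
  simpa [IsRoot] using Polynomial.finite_setOfPred_isRoot hf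

theorem Spl.spec [Infinite k] {f g : k[X]} (h : Spl f g) :
    ∀ᶠ t in Filter.cofinite, Spl (f.eval t) (g.eval t) := by
  obtain ⟨X, Y, Z, h0, h⟩ := h
  have h' : ∀ t, (X.eval t) ^ 2 = f.eval t * (Y.eval t) ^ 2 + g.eval t * (Z.eval t) ^ 2 := by
    intro t
    simp only [← Polynomial.eval_pow, ← Polynomial.eval_mul, ← Polynomial.eval_add, h]
  rcases h0 with h0 | h0 | h0
  · filter_upwards [ev_ne h0] with t ht using ⟨_, _, _, Or.inl ht, h' t⟩
  · filter_upwards [ev_ne h0] with t ht using ⟨_, _, _, Or.inr (Or.inl ht), h' t⟩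
  · filter_upwards [ev_ne h0] with t ht using ⟨_, _, _, Or.inr (Or.inr ht), h' t⟩

theorem faddeev [Infinite k] (hi : ∃ i : k, i ^ 2 = -1) (b c : k[X]) (hb : b ≠ 0) (hc : c ≠ 0)
    (hU : ∀ p, Irreducible p → Unr p b c)
    (hG : ∀ᶠ t in Filter.cofinite, Spl (b.eval t) (c.eval t)) : Spl b c := by
  generalize hN : b.natDegree + c.natDegree = N
  induction N using Nat.strong_induction_on generalizing b c with
  | _ N ih =>
  have step : ∀ b c c' : k[X], b ≠ 0 → c ≠ 0 → (∀ p, Irreducible p → Unr p b c) →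
      (∀ᶠ t in Filter.cofinite, Spl (b.eval t) (c.eval t)) → b.natDegree + c.natDegree = N →
      c' ≠ 0 → c'.natDegree < c.natDegree → Spl b (c * c') → Spl b c := by
    intro b c c' hb hc hU hG hN hc' hdeg hs
    have : Spl b c' := by
      refine ih (b.natDegree + c'.natDegree) (by omega) b c' hb hc' ?_ ?_ rfl
      · intro p hp
        exact (hU p hp).trans hp hc (hs.unr hi hp)
      · filter_upwards [hG, hs.spec, ev_ne hc] with t h1 h2 h3
        rw [Polynomial.eval_mul] at h2
        have := h1.mul h2
        apply Spl.of_sq h3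
        convert this using 1
        ring
    apply Spl.of_sq hc'
    convert hs.mul this using 1
    ring
  have sqf : ∀ b c : k[X], b ≠ 0 → c ≠ 0 → (∀ p, Irreducible p → Unr p b c) →
      (∀ᶠ t in Filter.cofinite, Spl (b.eval t) (c.eval t)) → b.natDegree + c.natDegree = N →
      ¬ Squarefree c → Spl b c := by
    intro b c hb hc hU hG hN hsq
    simp only [Squarefree, not_forall] at hsq
    obtain ⟨d, ⟨e, rfl⟩, hd⟩ := hsq
    have he : e ≠ 0 := right_ne_zero_of_mul hc
    have hd0 : d ≠ 0 := left_ne_zero_of_mul (left_ne_zero_of_mul hc)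
    refine step b _ e hb hc hU hG hN he ?_ ?_
    · have : 0 < d.natDegree := by
        rw [Nat.pos_iff_ne_zero]
        intro h0
        exact hd (isUnit_iff_degree_eq_zero.2 (by rw [degree_eq_natDegree hd0, h0]; rfl))
      rw [natDegree_mul (mul_ne_zero hd0 hd0) he, natDegree_mul hd0 hd0]
      omega
    · exact ⟨d * e, 0, 1, by simp, by ring⟩
  have main : ∀ b c : k[X], b ≠ 0 → c ≠ 0 → (∀ p, Irreducible p → Unr p b c) →
      (∀ᶠ t in Filter.cofinite, Spl (b.eval t) (c.eval t)) → b.natDegree + c.natDegree = N →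
      b.natDegree ≤ c.natDegree → Squarefree b → Squarefree c → Spl b c := by
    intro b c hb hc hU hG hN hle hsb hsc
    by_cases hc0 : c.natDegree = 0
    · obtain ⟨b0, rfl⟩ := natDegree_eq_zero.1 (show b.natDegree = 0 by omega)
      obtain ⟨c0, rfl⟩ := natDegree_eq_zero.1 hc0
      obtain ⟨t, ht⟩ := hG.exists
      simp only [Polynomial.eval_C] at ht
      exact ht.map Polynomial.C C_injective
    have hsq : SqMod c b := by
      apply sq_mod_sqfree c hsc hc
      rintro p hp ⟨w, rfl⟩
      by_cases hpb : p ∣ b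
      · exact ⟨0, by simpa using hpb⟩
      · have := hU p hp 0 1 b w (by simp) (by simp) hpb ?_
        · simpa using this
        · rintro ⟨d, rfl⟩
          exact hp.not_isUnit (hsc p ⟨d, by ring⟩)
    obtain ⟨r0, hr0⟩ := hsq
    obtain ⟨r, hr, hrd⟩ : ∃ r, c ∣ r ^ 2 - b ∧ r.natDegree < c.natDegree := by
      refine ⟨r0 % c, ?_, natDegree_mod_lt _ hc0⟩
      obtain ⟨v, hv⟩ := hr0
      rw [EuclideanDomain.mod_eq_sub_mul_div]
      exact ⟨v - 2 * r0 * (r0 / c) + c * (r0 / c) ^ 2, by linear_combination hv⟩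
    obtain ⟨c', hc'⟩ := hr
    by_cases hc'0 : c' = 0
    · refine ⟨r, 1, 0, by simp, ?_⟩
      rw [hc'0] at hc'
      linear_combination hc'
    · refine step b c c' hb hc hU hG hN hc'0 ?_ ⟨r, 1, 1, by simp, by linear_combination hc'⟩
      have h1 : (r ^ 2 - b).natDegree < 2 * c.natDegree := by
        refine lt_of_le_of_lt (natDegree_sub_le _ _) (max_lt ?_ (by omega))
        refine lt_of_le_of_lt natDegree_pow_le (by omega)
      rw [hc', natDegree_mul hc hc'0] at h1
      omega
  have hU' : ∀ p, Irreducible p → Unr p c b := fun p hp => (hU p hp).symm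
  have hG' : ∀ᶠ t in Filter.cofinite, Spl (c.eval t) (b.eval t) := hG.mono fun t ht => ht.symm
  by_cases h1 : Squarefree c
  · by_cases h2 : Squarefree b
    · rcases le_total b.natDegree c.natDegree with h | h
      · exact main b c hb hc hU hG hN h h2 h1
      · exact (main c b hc hb hU' hG' (by omega) h h1 h2).symm
    · exact (sqf c b hc hb hU' hG' (by omega) h2).symm
  · exact sqf b c hb hc hU hG hN h1

theorem sq_par {p u : k[X]} {m : ℕ} (h : Even m) : SqMod p (u ^ m) := by
  obtain ⟨m', rfl⟩ := h
  exact ⟨u ^ m', by ring_nf; simp⟩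

theorem sq_odd {p u : k[X]} {m : ℕ} (h : Odd m) (hu : SqMod p u) : SqMod p (u ^ m) := by
  obtain ⟨m', rfl⟩ := h
  rw [pow_succ]
  exact (sq_par ⟨m', by ring⟩).mul hu

theorem odd_sq {p u : k[X]} {m : ℕ} (hp : Irreducible p) (hpu : ¬ p ∣ u)
    (h : Odd m) (hu : SqMod p (u ^ m)) : SqMod p u := by
  obtain ⟨m', rfl⟩ := h
  rw [pow_succ, pow_mul', ] at hu
  exact SqMod.cancel_sq hp (fun h => hpu (hp.prime.dvd_of_dvd_pow h)) hu

/-- local computation of residues -/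
theorem local_unr {p b c x y : k[X]} (hp : Irreducible p) (hc : c ≠ 0)
    (hx : x ≠ 0) (hy : y ≠ 0) (h1 : Unr p b x) (h2 : Unr p x y) (h3 : Unr p b (y * c))
    (h4 : Unr p (b * x) c) : Unr p b c := by
  intro mb mc ub uc eb ec hub huc
  obtain ⟨mx, ux, ex, hux⟩ := decomp hp hx
  obtain ⟨my, uy, ey, huy⟩ := decomp hp hy
  have pm : ∀ {f g : k[X]}, ¬ p ∣ f → ¬ p ∣ g → ¬ p ∣ f * g :=
    fun hf hg h => (hp.prime.dvd_or_dvd h).elim hf hg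
  have pp : ∀ {f : k[X]} {n : ℕ}, ¬ p ∣ f → ¬ p ∣ f ^ n :=
    fun hf h => hf (hp.prime.dvd_of_dvd_pow h)
  have h1 := h1 _ _ _ _ eb ex hub hux
  have h2 := h2 _ _ _ _ ex ey hux huy
  have h3 := h3 _ (my + mc) _ (uy * uc) eb (by rw [ey, ec]; ring) hub (pm huy huc)
  have h4 := h4 (mb + mx) _ (ub * ux) _ (by rw [eb, ex]; ring) ec (pm hub hux) huc
  -- it suffices that the residue of `(b,y)` or of `(x,c)` vanishes
  have sBY : SqMod p (ub ^ my * uy ^ mb) → SqMod p (ub ^ mc * uc ^ mb) := by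
    intro h
    apply SqMod.cancel hp (pm (pp hub) (pp huy)) h
    convert h3 using 1
    ring
  have sXC : SqMod p (ux ^ mc * uc ^ mx) → SqMod p (ub ^ mc * uc ^ mb) := by
    intro h
    apply SqMod.cancel hp (pm (pp hux) (pp huc)) h
    convert h4 using 1
    ring
  rcases Nat.even_or_odd mb with hb | hb <;> rcases Nat.even_or_odd mx with hx | hx
  · rcases Nat.even_or_odd mc with hc | hc
    · exact (sq_par hc).mul (sq_par hb)
    rcases Nat.even_or_odd my with hy | hy
    · exact sBY ((sq_par hy).mul (sq_par hb))
    · apply sXC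
      refine SqMod.mul (sq_odd hc ?_) (sq_par hx)
      apply odd_sq hp hux hy
      rw [mul_comm] at h2
      exact SqMod.cancel hp (pp huy) (sq_par hx) h2
  · have : SqMod p ub := by
      apply odd_sq hp hub hx
      rw [mul_comm] at h1
      exact SqMod.cancel hp (pp hux) (sq_par hb) h1
    rcases Nat.even_or_odd mc with hc | hc
    · exact (sq_par hc).mul (sq_par hb)
    · exact (sq_odd hc this).mul (sq_par hb)
  · have : SqMod p ux := by
      apply odd_sq hp hux hb
      exact SqMod.cancel hp (pp hub) (sq_par hx) h1
    apply sXC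
    rcases Nat.even_or_odd mc with hc | hc
    · exact (sq_par hc).mul (sq_par hx)
    · exact (sq_odd hc this).mul (sq_par hx)
  · -- both odd
    apply sBY
    obtain ⟨b', rfl⟩ := hb
    obtain ⟨x', rfl⟩ := hx
    have hbx : SqMod p (ub * ux) := by
      apply SqMod.cancel_sq hp (a := ub ^ x' * ux ^ b') (pm (pp hub) (pp hux))
      convert h1 using 1
      ring
    have hbx' : SqMod p ((ub * ux) ^ my) := by
      rcases Nat.even_or_odd my with hy | hy
      · exact sq_par hy
      · exact sq_odd hy hbx
    apply SqMod.cancel_sq hp (a := ux ^ my * uy ^ x') (pm (pp hux) (pp huy))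
    convert (hbx'.mul h2).mul (SqMod.sq p (uy ^ b')) using 1
    ring

theorem PP.poly [Infinite k] (hi : ∃ i : k, i ^ 2 = -1) (h : PP k) : PP k[X] := by
  intro b c x y hb hc hx hy h1 h2 h3 h4
  apply faddeev hi b c hb hc
  · intro p hp
    exact local_unr hp hc hx hy (h1.unr hi hp) (h2.unr hi hp) (h3.unr hi hp) (h4.unr hi hp)
  · filter_upwards [h1.spec, h2.spec, h3.spec, h4.spec, ev_ne hb, ev_ne hc, ev_ne hx, ev_ne hy]
      with t g1 g2 g3 g4 g5 g6 g7 g8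
    rw [Polynomial.eval_mul] at g3 g4
    exact h _ _ _ _ g5 g6 g7 g8 g1 g2 g3 g4

end Faddeev

theorem PP.mvPoly (m : ℕ) : PP (MvPolynomial (Fin m) ℂ) := by
  induction m with
  | zero =>
    refine PP.of_equiv (MvPolynomial.isEmptyAlgEquiv ℂ (Fin 0)).symm.toRingEquiv ?_
    intro b c x y _ _ _ _ _ _ _ _
    obtain ⟨s, hs⟩ := IsAlgClosed.exists_pow_nat_eq b (n := 2) (by norm_num)
    exact ⟨s, 1, 0, by simp, by rw [hs]; ring⟩
  | succ m ih =>
    refine PP.of_equiv (MvPolynomial.finSuccEquiv ℂ m).symm.toRingEquiv ?_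
    let F := FractionRing (MvPolynomial (Fin m) ℂ)
    have h1 : PP F := PP.to_frac (R := MvPolynomial (Fin m) ℂ) ih
    have : CharZero F := algebraRat.charZero F
    have h2 : PP F[X] := PP.poly ⟨algebraMap ℂ F Complex.I, by rw [← map_pow]; simp⟩ h1
    letI : Algebra (MvPolynomial (Fin m) ℂ)[X] F[X] := (mapRingHom (algebraMap _ F)).toAlgebra
    have := Polynomial.isLocalization (nonZeroDivisors (MvPolynomial (Fin m) ℂ)) F
    refine PP.of_loc (S := F[X]) (Submonoid.map Polynomial.C (nonZeroDivisors (MvPolynomial (Fin m) ℂ))) ?_ h2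
    rintro _ ⟨a, ha, rfl⟩
    rw [mem_nonZeroDivisors_iff_ne_zero]
    simpa using nonZeroDivisors.ne_zero ha

theorem PP.frac (m : ℕ) : PP (FractionRing (MvPolynomial (Fin m) ℂ)) :=
  PP.to_frac (R := MvPolynomial (Fin m) ℂ) (PP.mvPoly m)
end BB


section Generic

theorem relPrime_act {R : Type*} [CommRing R] (s : R ≃+* R)
    {A B : R} (h : IsRelPrime A B) : IsRelPrime (s A) (s B) := by
  intro d h1 h2
  have h1' := map_dvd s.symm h1
  have h2' := map_dvd s.symm h2
  rw [RingEquiv.symm_apply_apply] at h1' h2'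
  have := (h h1' h2').map s
  rwa [RingEquiv.apply_symm_apply] at this

theorem nosplit_core {R L : Type*} [CommRing R] [IsDomain R] [UniqueFactorizationMonoid R]
    [Field L] [Algebra R L] [IsFractionRing R L] (h2 : (2 : R) ≠ 0)
    (sb sc sx sy : R ≃+* R) (tb tc tx ty : L ≃+* L)
    (cb : ∀ r, tb (algebraMap R L r) = algebraMap R L (sb r))
    (cc : ∀ r, tc (algebraMap R L r) = algebraMap R L (sc r))
    (cx : ∀ r, tx (algebraMap R L r) = algebraMap R L (sx r))
    (cy : ∀ r, ty (algebraMap R L r) = algebraMap R L (sy r))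
    (ub : ∀ u : Rˣ, sb u = u) (uc : ∀ u : Rˣ, sc u = u) (ux : ∀ u : Rˣ, sx u = u)
    (uy : ∀ u : Rˣ, sy u = u)
    (rel : ∀ r, sc (sy (sb (sx (sc r)))) = sb (sc (sy (sc (sx r))))) (h : L)
    (hc : tc h = -h) (hx : tx h = h) (hy : ty h = h)
    (hb : tb h * h = 1) : False := by
  obtain ⟨A, ⟨B, hB⟩, hAB, rfl⟩ := IsFractionRing.exists_reduced_fraction R h
  have hB0 : B ≠ 0 := nonZeroDivisors.ne_zero hB
  simp only at hAB
  have hinj := IsFractionRing.injective R L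
  have nz : ∀ p : R, p ≠ 0 → algebraMap R L p ≠ 0 := by
    intro p hp
    rwa [Ne, map_eq_zero_iff _ hinj]
  have hgB0 : ∀ s : R ≃+* R, s B ≠ 0 := fun g => by simpa using hB0
  simp only [IsFractionRing.mk'_eq_div, map_div₀, cb, cc, cx, cy] at hc hx hy hb
  -- semi-invariance
  have semi : ∀ (s : R ≃+* R), s A * B ∣ A * s B → A * s B ∣ s A * B →
      ∃ a : Rˣ, s B = a * B := by
    intro s h h'
    obtain ⟨u, hu⟩ := associated_of_dvd_dvd
      (hAB.symm.dvd_of_dvd_mul_left ((Dvd.intro_left _ rfl).trans h))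
      ((relPrime_act s hAB).symm.dvd_of_dvd_mul_left ((Dvd.intro_left _ rfl).trans h'))
    exact ⟨u, by rw [← hu, mul_comm]⟩
  have ec : sc A * B = - (A * sc B) := by
    apply hinj
    rw [← neg_div, div_eq_div_iff (nz _ (hgB0 sc)) (nz _ hB0)] at hc
    simp only [map_mul, map_neg]
    linear_combination hc
  have ex : sx A * B = A * sx B := by
    apply hinj
    rw [div_eq_div_iff (nz _ (hgB0 sx)) (nz _ hB0)] at hx
    simpa only [map_mul] using hx
  have ey : sy A * B = A * sy B := by
    apply hinj
    rw [div_eq_div_iff (nz _ (hgB0 sy)) (nz _ hB0)] at hy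
    simpa only [map_mul] using hy
  have eb : sb A * A = sb B * B := by
    apply hinj
    rw [div_mul_div_comm, div_eq_one_iff_eq (mul_ne_zero (nz _ (hgB0 sb)) (nz _ hB0))] at hb
    simpa only [map_mul] using hb
  obtain ⟨pc, hpc⟩ := semi sc (by rw [ec, neg_dvd]) (by rw [ec, dvd_neg])
  obtain ⟨px, hpx⟩ := semi sx (by rw [ex]) (by rw [ex])
  obtain ⟨py, hpy⟩ := semi sy (by rw [ey]) (by rw [ey])
  obtain ⟨l, hl⟩ : ∃ a : Rˣ, sb B = a * A := by
    have hd : A ∣ sb B * B := ⟨sb A, by rw [← eb]; ring⟩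
    obtain ⟨u, hu⟩ := associated_of_dvd_dvd
      (hAB.dvd_of_dvd_mul_right hd)
      ((relPrime_act sb hAB).symm.dvd_of_dvd_mul_left ⟨B, eb⟩)
    exact ⟨u, by rw [← hu, mul_comm]⟩
  have hcA : sc A = - (pc * A) := by
    apply mul_right_cancel₀ hB0
    rw [ec, hpc]; ring
  have hyA : sy A = py * A := by
    apply mul_right_cancel₀ hB0
    rw [ey, hpy]; ring
  have h1 := rel B
  simp only [map_mul, map_neg, hpc, hpx, hpy, hl, hcA, hyA, ub, uc, ux, uy] at h1
  have hA0 : A ≠ 0 := by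
    rintro rfl
    rw [mul_zero] at hl
    exact hgB0 sb hl
  have h3 : 2 * (pc * px * py * pc * l * A : R) = 0 := by linear_combination -h1
  have := pc.ne_zero
  have := px.ne_zero
  have := py.ne_zero
  have := l.ne_zero
  simp_all

theorem fix_closure {L Γ : Type*} [Field L] [Group Γ] (φ : Γ →* (L ≃+* L)) (S : Set Γ)
    (f : L) (hS : ∀ g ∈ S, φ g f = f) {g : Γ} (hg : g ∈ Subgroup.closure S) : φ g f = f := by
  induction hg using Subgroup.closure_induction with
  | mem g hg => exact hS g hg
  | one => simp
  | mul a b _ _ ha hb => rw [map_mul, RingAut.mul_apply, hb, ha]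
  | inv a _ ha =>
    rw [map_inv]
    change (φ a).symm f = f
    rw [RingEquiv.symm_apply_eq, ha]

open Equiv in
def pib : Perm (Fin 12) := swap 4 5 * swap 8 9 * swap 10 11
open Equiv in
def pix : Perm (Fin 12) := swap 6 7 * swap 10 11
def epb : Fin 12 → ℤˣ := ![-1, 1, 1, 1, 1, 1, 1, 1, 1, 1, 1, 1]
def epc : Fin 12 → ℤˣ := ![1, -1, 1, 1, 1, 1, 1, 1, 1, -1, 1, -1]
def epx : Fin 12 → ℤˣ := ![1, 1, -1, 1, 1, -1, 1, 1, 1, 1, 1, 1]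
def epy : Fin 12 → ℤˣ := ![1, 1, 1, -1, 1, 1, 1, -1, 1, -1, 1, 1]

theorem norm_rel {L : Type*} [Field L] [CharZero L] (F G u v : L) (hF : F ≠ 0) (hu : u ≠ 0)
    (hv : v ≠ 0) : (G * (u / v + v / u) / 2) ^ 2 =
      F ^ 2 * (G * (u / v - v / u) / (2 * F)) ^ 2 + G ^ 2 * 1 ^ 2 := by
  field_simp
  ring

theorem rel_spl {L : Type*} [Field L] [CharZero L] (tb tc tx ty : L ≃+* L) (K : Subfield L)
    (hK : ∀ f, f ∈ K ↔ tb f = f ∧ tc f = f ∧ tx f = f ∧ ty f = f)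
    (F G u v : L) (hF : F ≠ 0) (hu : u ≠ 0) (hv : v ≠ 0) (b c : K) (hb : (b : L) = F ^ 2)
    (hc : (c : L) = G ^ 2)
    (H : ∀ t ∈ [tb, tc, tx, ty], (t F = F ∧ t G = G ∧ t u = u ∧ t v = v) ∨
      (t F = F ∧ t G = -G ∧ t u = u ∧ t v = -v) ∨ (t F = -F ∧ t G = G ∧ t u = v ∧ t v = u)) :
    Spl b c := by
  have key : ∀ t ∈ [tb, tc, tx, ty], t (G * (u / v + v / u) / 2) = G * (u / v + v / u) / 2 ∧
      t (G * (u / v - v / u) / (2 * F)) = G * (u / v - v / u) / (2 * F) := by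
    intro t ht
    rcases H t ht with ⟨h1, h2, h3, h4⟩ | ⟨h1, h2, h3, h4⟩ | ⟨h1, h2, h3, h4⟩ <;>
    · simp only [map_div₀, map_mul, map_add, map_sub, map_ofNat, h1, h2, h3, h4]
      constructor <;> first | trivial | rfl | (simp only [div_neg, neg_div]; ring1) | (field_simp; done) | (field_simp; ring1)
  simp only [List.mem_cons, List.not_mem_nil, or_false, forall_eq_or_imp, forall_eq] at key
  obtain ⟨k1, k2, k3, k4⟩ := key
  refine ⟨⟨_, (hK _).2 ⟨k1.1, k2.1, k3.1, k4.1⟩⟩, ⟨_, (hK _).2 ⟨k1.2, k2.2, k3.2, k4.2⟩⟩, 1,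
    by simp, ?_⟩
  apply Subtype.ext
  push_cast
  rw [hb, hc]
  exact norm_rel F G u v hF hu hv

theorem generic_ex {L : Type*} [Field L] [CharZero L] (tb tc tx ty : L ≃+* L) (K : Subfield L)
    (hK : ∀ f, f ∈ K ↔ tb f = f ∧ tc f = f ∧ tx f = f ∧ ty f = f)
    (v : Fin 12 → L) (hv : ∀ i, v i ≠ 0)
    (hb : ∀ i, tb (v i) = ((epb i : ℤ) : L) * v (pib i))
    (hc : ∀ i, tc (v i) = ((epc i : ℤ) : L) * v i)
    (hx : ∀ i, tx (v i) = ((epx i : ℤ) : L) * v (pix i))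
    (hy : ∀ i, ty (v i) = ((epy i : ℤ) : L) * v i)
    (core : ∀ h : L, tc h = -h → tx h = h → ty h = h → tb h * h = 1 → False) :
    ∃ b c x y : K, (b ≠ 0 ∧ c ≠ 0 ∧ x ≠ 0 ∧ y ≠ 0) ∧ Spl b x ∧ Spl x y ∧ Spl b (y * c) ∧
      Spl (b * x) c ∧ ¬ Spl b c := by
  obtain ⟨b0, b1, b2, b3, b4, b5, b6, b7, b8, b9, b10, b11⟩ :
      tb (v 0) = - v 0 ∧ tb (v 1) = v 1 ∧ tb (v 2) = v 2 ∧ tb (v 3) = v 3 ∧ tb (v 4) = v 5 ∧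
      tb (v 5) = v 4 ∧ tb (v 6) = v 6 ∧ tb (v 7) = v 7 ∧ tb (v 8) = v 9 ∧ tb (v 9) = v 8 ∧
      tb (v 10) = v 11 ∧ tb (v 11) = v 10 := by
    refine ⟨?_, ?_, ?_, ?_, ?_, ?_, ?_, ?_, ?_, ?_, ?_, ?_⟩ <;>
    · rw [hb]
      simp [epb, pib, Equiv.swap_apply_def]
  obtain ⟨c0, c1, c2, c3, c4, c5, c6, c7, c8, c9, c10, c11⟩ :
      tc (v 0) = v 0 ∧ tc (v 1) = - v 1 ∧ tc (v 2) = v 2 ∧ tc (v 3) = v 3 ∧ tc (v 4) = v 4 ∧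
      tc (v 5) = v 5 ∧ tc (v 6) = v 6 ∧ tc (v 7) = v 7 ∧ tc (v 8) = v 8 ∧ tc (v 9) = - v 9 ∧
      tc (v 10) = v 10 ∧ tc (v 11) = - v 11 := by
    refine ⟨?_, ?_, ?_, ?_, ?_, ?_, ?_, ?_, ?_, ?_, ?_, ?_⟩ <;>
    · rw [hc]
      simp [epc]
  obtain ⟨x0, x1, x2, x3, x4, x5, x6, x7, x8, x9, x10, x11⟩ :
      tx (v 0) = v 0 ∧ tx (v 1) = v 1 ∧ tx (v 2) = - v 2 ∧ tx (v 3) = v 3 ∧ tx (v 4) = v 4 ∧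
      tx (v 5) = - v 5 ∧ tx (v 6) = v 7 ∧ tx (v 7) = v 6 ∧ tx (v 8) = v 8 ∧ tx (v 9) = v 9 ∧
      tx (v 10) = v 11 ∧ tx (v 11) = v 10 := by
    refine ⟨?_, ?_, ?_, ?_, ?_, ?_, ?_, ?_, ?_, ?_, ?_, ?_⟩ <;>
    · rw [hx]
      simp [epx, pix, Equiv.swap_apply_def]
  obtain ⟨y0, y1, y2, y3, y4, y5, y6, y7, y8, y9, y10, y11⟩ :
      ty (v 0) = v 0 ∧ ty (v 1) = v 1 ∧ ty (v 2) = v 2 ∧ ty (v 3) = - v 3 ∧ ty (v 4) = v 4 ∧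
      ty (v 5) = v 5 ∧ ty (v 6) = v 6 ∧ ty (v 7) = - v 7 ∧ ty (v 8) = v 8 ∧ ty (v 9) = - v 9 ∧
      ty (v 10) = v 10 ∧ ty (v 11) = v 11 := by
    refine ⟨?_, ?_, ?_, ?_, ?_, ?_, ?_, ?_, ?_, ?_, ?_, ?_⟩ <;>
    · rw [hy]
      simp [epy]
  clear hb hc hx hy
  have m0 : v 0 ^ 2 ∈ K := by rw [hK]; simp [b0, c0, x0, y0]
  have m1 : v 1 ^ 2 ∈ K := by rw [hK]; simp [b1, c1, x1, y1]
  have m2 : v 2 ^ 2 ∈ K := by rw [hK]; simp [b2, c2, x2, y2]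
  have m3 : v 3 ^ 2 ∈ K := by rw [hK]; simp [b3, c3, x3, y3]
  have nz : ∀ (i : Fin 12) (m : v i ^ 2 ∈ K), (⟨v i ^ 2, m⟩ : K) ≠ 0 := by
    intro i m h
    exact pow_ne_zero 2 (hv i) (congrArg Subtype.val h)
  refine ⟨⟨_, m0⟩, ⟨_, m1⟩, ⟨_, m2⟩, ⟨_, m3⟩, ⟨nz _ _, nz _ _, nz _ _, nz _ _⟩, ?_, ?_, ?_, ?_, ?_⟩
  · refine rel_spl tb tc tx ty K hK (v 0) (v 2) (v 4) (v 5) (hv _) (hv _) (hv _) _ _ rfl rfl ?_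
    simp [*]
  · refine rel_spl tb tc tx ty K hK (v 2) (v 3) (v 6) (v 7) (hv _) (hv _) (hv _) _ _ rfl rfl ?_
    simp [*]
  · refine rel_spl tb tc tx ty K hK (v 0) (v 3 * v 1) (v 8) (v 9) (hv _) (hv _) (hv _) _ _ rfl
      (by push_cast; ring) ?_
    simp [*]
  · refine rel_spl tb tc tx ty K hK (v 0 * v 2) (v 1) (v 10) (v 11) (mul_ne_zero (hv _) (hv _))
      (hv _) (hv _) _ _ (by push_cast; ring) rfl ?_
    simp [*]
  · rintro ⟨⟨X, hX⟩, ⟨Y, hY⟩, ⟨Z, hZ⟩, h0, h⟩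
    have h : X ^ 2 = v 0 ^ 2 * Y ^ 2 + v 1 ^ 2 * Z ^ 2 := congrArg Subtype.val h
    have h0 : X ≠ 0 ∨ Y ≠ 0 ∨ Z ≠ 0 := by
      simpa [Subtype.ext_iff] using h0
    obtain ⟨Xb, Xc, Xx, Xy⟩ := (hK X).1 hX
    obtain ⟨Yb, Yc, Yx, Yy⟩ := (hK Y).1 hY
    obtain ⟨Zb, Zc, Zx, Zy⟩ := (hK Z).1 hZ
    have v0 := hv 0
    have v1 := hv 1
    have hZ0 : Z ≠ 0 := by
      rintro rfl
      have e : (X - v 0 * Y) * (X + v 0 * Y) = 0 := by linear_combination h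
      have e2 : X = v 0 * Y ∧ X = - (v 0 * Y) := by
        rcases mul_eq_zero.1 e with e | e
        · have e' := congrArg tb e
          simp only [map_sub, map_mul, Xb, Yb, b0, map_zero] at e'
          exact ⟨by linear_combination e, by linear_combination e'⟩
        · have e' := congrArg tb e
          simp only [map_add, map_mul, Xb, Yb, b0, map_zero] at e'
          exact ⟨by linear_combination e', by linear_combination e⟩
      have e3 : (2 : L) * X = 0 := by linear_combination e2.1 + e2.2
      have e4 : X = 0 := by simpa using e3
      have e5 : Y = 0 := by
        have := e2.1
        rw [e4] at this
        simpa [v0] using this.symm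
      simp [e4, e5] at h0
    apply core ((X + v 0 * Y) / (v 1 * Z))
    · simp only [map_div₀, map_add, map_mul, Xc, Yc, Zc, c0, c1]
      field_simp
    · simp only [map_div₀, map_add, map_mul, Xx, Yx, Zx, x0, x1]
    · simp only [map_div₀, map_add, map_mul, Xy, Yy, Zy, y0, y1]
    · simp only [map_div₀, map_add, map_mul, Xb, Yb, Zb, b0, b1]
      field_simp
      linear_combination h

end Generic

section NoetherAction

/-- linear substitution -/
noncomputable def matHom (n : ℕ) :
    Matrix (Fin n) (Fin n) ℂ →* (MvPolynomial (Fin n) ℂ →ₐ[ℂ] MvPolynomial (Fin n) ℂ) where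
  toFun M := aeval (fun i => ∑ j, M j i • X j)
  map_one' := by
    ext1 i
    simp [Matrix.one_apply, ite_smul]
  map_mul' M N := by
    ext1 i
    simp only [aeval_X, AlgHom.mul_apply, map_sum, map_smul, Matrix.mul_apply, Finset.sum_smul,
      Finset.smul_sum, smul_smul]
    rw [Finset.sum_comm]
    refine Finset.sum_congr rfl fun j _ => Finset.sum_congr rfl fun l _ => ?_
    rw [mul_comm]

noncomputable def polyAct (n : ℕ) : Matrix.GeneralLinearGroup (Fin n) ℂ →*
    (MvPolynomial (Fin n) ℂ ≃ₐ[ℂ] MvPolynomial (Fin n) ℂ) :=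
  (AlgEquiv.algHomUnitsEquiv ℂ (MvPolynomial (Fin n) ℂ)).toMonoidHom.comp (Units.map (matHom n))

theorem polyAct_X {n : ℕ} (g : Matrix.GeneralLinearGroup (Fin n) ℂ) (i : Fin n) :
    polyAct n g (X i) = ∑ j, (g : Matrix (Fin n) (Fin n) ℂ) j i • X j := by
  change aeval (fun i => ∑ j, (g : Matrix (Fin n) (Fin n) ℂ) j i • X j) (X i) = _
  rw [aeval_X]

noncomputable def ratAct (n : ℕ) : Matrix.GeneralLinearGroup (Fin n) ℂ →*
    (CRatFunc n ≃ₐ[ℂ] CRatFunc n) :=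
  (IsFractionRing.fieldEquivOfAlgEquivHom ℂ (CRatFunc n)).comp (polyAct n)

theorem ratAct_alg {n : ℕ} (g : Matrix.GeneralLinearGroup (Fin n) ℂ) (p : MvPolynomial (Fin n) ℂ) :
    ratAct n g (algebraMap _ (CRatFunc n) p) = algebraMap _ (CRatFunc n) (polyAct n g p) :=
  IsFractionRing.fieldEquivOfAlgEquiv_algebraMap ℂ (CRatFunc n) (CRatFunc n) _ _

/-- signed permutation matrices -/
def mono {n : ℕ} (π : Equiv.Perm (Fin n)) (ε : Fin n → ℤˣ) : Matrix (Fin n) (Fin n) ℂ :=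
  Matrix.of fun j i => if j = π i then ((ε i : ℤ) : ℂ) else 0

theorem mono_mul {n : ℕ} (π π' : Equiv.Perm (Fin n)) (ε ε' : Fin n → ℤˣ) :
    mono π ε * mono π' ε' = mono (π * π') (fun i => ε (π' i) * ε' i) := by
  ext j i
  simp only [mono, Matrix.mul_apply, Matrix.of_apply, mul_ite, mul_zero, Finset.sum_ite_eq',
    Finset.sum_ite_eq, Finset.mem_univ, if_true, Equiv.Perm.mul_apply]
  split_ifs <;> simp_all

theorem mono_one {n : ℕ} : mono (1 : Equiv.Perm (Fin n)) 1 = 1 := by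
  ext j i
  simp [mono, Matrix.one_apply]

/-- signed permutation matrices as invertible matrices -/
def monoGL {n : ℕ} (π : Equiv.Perm (Fin n)) (ε : Fin n → ℤˣ) :
    Matrix.GeneralLinearGroup (Fin n) ℂ where
  val := mono π ε
  inv := mono π⁻¹ (fun i => ε (π⁻¹ i))
  val_inv := by
    rw [mono_mul, ← mono_one]
    congr 1
    · simp
    · ext i; simp
  inv_val := by
    rw [mono_mul, ← mono_one]
    congr 1
    · simp
    · ext i; simp

theorem monoGL_mul {n : ℕ} (π π' : Equiv.Perm (Fin n)) (ε ε' : Fin n → ℤˣ) :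
    monoGL π ε * monoGL π' ε' = monoGL (π * π') (fun i => ε (π' i) * ε' i) :=
  Units.ext (mono_mul _ _ _ _)

theorem monoGL_inv {n : ℕ} (π : Equiv.Perm (Fin n)) (ε : Fin n → ℤˣ) :
    (monoGL π ε)⁻¹ = monoGL π⁻¹ (fun i => ε (π⁻¹ i)) :=
  Units.ext rfl

/-- the group of signed permutation matrices -/
def monoGrp (n : ℕ) : Subgroup (Matrix.GeneralLinearGroup (Fin n) ℂ) where
  carrier := Set.range fun p : Equiv.Perm (Fin n) × (Fin n → ℤˣ) => monoGL p.1 p.2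
  mul_mem' := by
    rintro _ _ ⟨p, rfl⟩ ⟨q, rfl⟩
    exact ⟨(_, _), (monoGL_mul _ _ _ _).symm⟩
  one_mem' := ⟨(1, 1), Units.ext mono_one⟩
  inv_mem' := by
    rintro _ ⟨p, rfl⟩
    exact ⟨(_, _), (monoGL_inv _ _).symm⟩

theorem monoGrp_finite (n : ℕ) : Finite (monoGrp n) :=
  Set.finite_range (fun p : Equiv.Perm (Fin n) × (Fin n → ℤˣ) => monoGL p.1 p.2)

/-- coordinate functions -/
noncomputable def xx {n : ℕ} (i : Fin n) : CRatFunc n :=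
  algebraMap (MvPolynomial (Fin n) ℂ) (CRatFunc n) (X i)

theorem xx_ne {n : ℕ} (i : Fin n) : xx (n := n) i ≠ 0 := by
  rw [xx, Ne, map_eq_zero_iff _ (IsFractionRing.injective _ _)]
  exact X_ne_zero i

theorem ratAct_xx {n : ℕ} (π : Equiv.Perm (Fin n)) (ε : Fin n → ℤˣ) (i : Fin n) :
    ratAct n (monoGL π ε) (xx i) = ((ε i : ℤ) : CRatFunc n) * xx (π i) := by
  rw [xx, ratAct_alg, polyAct_X]
  have : ∀ j, ((monoGL π ε : Matrix.GeneralLinearGroup (Fin n) ℂ) : Matrix (Fin n) (Fin n) ℂ) j i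
      = if j = π i then ((ε i : ℤ) : ℂ) else 0 := fun j => rfl
  simp only [this, ite_smul, zero_smul, Finset.sum_ite_eq', Finset.mem_univ, if_true]
  rw [smul_eq_C_mul, map_mul, xx]
  simp


end NoetherAction

section Final

theorem mem_fix_iff {F L Γ : Type*} [Field F] [Field L] [Algebra F L] [Group Γ]
    (φ : Γ →* (L ≃ₐ[F] L)) (S : Set Γ) (f : L) :
    f ∈ (IntermediateField.fixedField (φ.comp (Subgroup.closure S).subtype).range).toSubfield ↔
      ∀ g ∈ S, φ g f = f := by
  change f ∈ IntermediateField.fixedField (φ.comp (Subgroup.closure S).subtype).range ↔ _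
  rw [IntermediateField.mem_fixedField_iff]
  constructor
  · intro h g hg
    exact h (φ g) ⟨⟨g, Subgroup.subset_closure hg⟩, rfl⟩
  · rintro h _ ⟨⟨g, hg⟩, rfl⟩
    change φ g f = f
    induction hg using Subgroup.closure_induction with
    | mem g hg => exact h g hg
    | one => simp
    | mul a b _ _ ha hb => rw [map_mul, AlgEquiv.mul_apply, hb, ha]
    | inv a _ ha =>
      rw [map_inv]
      change (φ a).symm f = f
      rw [AlgEquiv.symm_apply_eq, ha]

theorem polyAct_unit {n : ℕ} (g : Matrix.GeneralLinearGroup (Fin n) ℂ)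
    (u : (MvPolynomial (Fin n) ℂ)ˣ) :
    (polyAct n g).toRingEquiv (u : MvPolynomial (Fin n) ℂ) = u := by
  obtain ⟨r, _, hr⟩ := MvPolynomial.isUnit_iff_eq_C_of_isReduced.1 u.isUnit
  rw [hr]
  exact (polyAct n g).commutes r

theorem nosplit_n {n : ℕ} (gb gc gx gy : Matrix.GeneralLinearGroup (Fin n) ℂ)
    (rel : gc * gy * gb * (gx * gc) = gb * (gc * gy) * (gc * gx)) (h : CRatFunc n)
    (hc : (ratAct n gc).toRingEquiv h = -h) (hx : (ratAct n gx).toRingEquiv h = h)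
    (hy : (ratAct n gy).toRingEquiv h = h)
    (hb : (ratAct n gb).toRingEquiv h * h = 1) : False := by
  refine nosplit_core (R := MvPolynomial (Fin n) ℂ) (L := CRatFunc n) two_ne_zero
    (polyAct n gb).toRingEquiv (polyAct n gc).toRingEquiv (polyAct n gx).toRingEquiv
    (polyAct n gy).toRingEquiv (ratAct n gb).toRingEquiv (ratAct n gc).toRingEquiv
    (ratAct n gx).toRingEquiv (ratAct n gy).toRingEquiv
    (ratAct_alg gb) (ratAct_alg gc) (ratAct_alg gx) (ratAct_alg gy)
    (polyAct_unit gb) (polyAct_unit gc) (polyAct_unit gx) (polyAct_unit gy) ?_ h hc hx hy hb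
  intro r
  have := congrArg (fun g => polyAct n g r) rel
  simp only [map_mul, AlgEquiv.mul_apply] at this
  exact this

def Gb : Matrix.GeneralLinearGroup (Fin 12) ℂ := monoGL pib epb
def Gc : Matrix.GeneralLinearGroup (Fin 12) ℂ := monoGL 1 epc
def Gx : Matrix.GeneralLinearGroup (Fin 12) ℂ := monoGL pix epx
def Gy : Matrix.GeneralLinearGroup (Fin 12) ℂ := monoGL 1 epy

theorem GG_rel : Gc * Gy * Gb * (Gx * Gc) = Gb * (Gc * Gy) * (Gc * Gx) := by
  simp only [Gb, Gc, Gx, Gy, monoGL_mul]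
  congr 1
  decide +kernel

/-- the group of the counterexample -/
def GG : Subgroup (Matrix.GeneralLinearGroup (Fin 12) ℂ) := Subgroup.closure {Gb, Gc, Gx, Gy}

theorem GG_finite : Finite GG := by
  have hle : GG ≤ monoGrp 12 := by
    rw [GG, Subgroup.closure_le]
    rintro g (rfl | rfl | rfl | rfl) <;> exact ⟨(_, _), rfl⟩
  have := monoGrp_finite 12
  exact Finite.of_injective _ (Subgroup.inclusion_injective hle)

noncomputable def rho : GG →* (CRatFunc 12 ≃ₐ[ℂ] CRatFunc 12) := (ratAct 12).comp GG.subtype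

theorem not_PP_fix_aux :
    ¬ PP ((IntermediateField.fixedField rho.range).toSubfield) := by
  have : CharZero (CRatFunc 12) := algebraRat.charZero _
  obtain ⟨b, c, x, y, ⟨hb, hc, hx, hy⟩, h1, h2, h3, h4, h5⟩ := generic_ex (L := CRatFunc 12)
    (ratAct 12 Gb).toRingEquiv (ratAct 12 Gc).toRingEquiv
    (ratAct 12 Gx).toRingEquiv (ratAct 12 Gy).toRingEquiv
    (IntermediateField.fixedField rho.range).toSubfield
    (by
      intro f
      refine (mem_fix_iff (ratAct 12) {Gb, Gc, Gx, Gy} f).trans ?_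
      simp only [Set.mem_insert_iff, Set.mem_singleton_iff, forall_eq_or_imp, forall_eq]
      exact Iff.rfl)
    xx xx_ne (ratAct_xx _ _) (ratAct_xx _ _) (ratAct_xx _ _) (ratAct_xx _ _)
    (nosplit_n Gb Gc Gx Gy GG_rel)
  exact fun h => h5 (h b c x y hb hc hx hy h1 h2 h3 h4)

theorem not_PP_fix : ¬ PP (IntermediateField.fixedField rho.range) := not_PP_fix_aux

theorem PP.of_fracPoly {K : Type*} [Field K] [Infinite K] (n : ℕ)
    (h : PP (FractionRing (MvPolynomial (Fin n) K))) : PP K := by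
  intro b c x y hb hc hx hy h1 h2 h3 h4
  have hinj : Function.Injective ((algebraMap (MvPolynomial (Fin n) K)
      (FractionRing (MvPolynomial (Fin n) K))).comp (C : K →+* MvPolynomial (Fin n) K)) :=
    RingHom.injective _
  have key := h _ _ _ _ ((map_ne_zero_iff _ hinj).2 hb) ((map_ne_zero_iff _ hinj).2 hc)
    ((map_ne_zero_iff _ hinj).2 hx) ((map_ne_zero_iff _ hinj).2 hy) (h1.map _ hinj)
    (h2.map _ hinj) (by rw [← map_mul]; exact h3.map _ hinj)
    (by rw [← map_mul]; exact h4.map _ hinj)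
  obtain ⟨X, Y, Z, h0, e⟩ : Spl (C b : MvPolynomial (Fin n) K) (C c) :=
    Spl.unmap (S := FractionRing (MvPolynomial (Fin n) K)) (nonZeroDivisors _) le_rfl key
  have ex : ∀ p : MvPolynomial (Fin n) K, p ≠ 0 → ∃ a, eval a p ≠ 0 := by
    intro p hp
    by_contra! hh
    exact hp (MvPolynomial.funext fun a => by rw [hh a, map_zero])
  have ee : ∀ a, (eval a X) ^ 2 = b * (eval a Y) ^ 2 + c * (eval a Z) ^ 2 := by
    intro a
    simpa using congrArg (eval a) e
  rcases h0 with h0 | h0 | h0 <;> obtain ⟨a, ha⟩ := ex _ h0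
  · exact ⟨_, _, _, Or.inl ha, ee a⟩
  · exact ⟨_, _, _, Or.inr (Or.inl ha), ee a⟩
  · exact ⟨_, _, _, Or.inr (Or.inr ha), ee a⟩

theorem PP.of_pure {K : Type*} [CommRing K] [Algebra ℂ K] (h : IsPurelyTranscendental K) :
    PP K := by
  obtain ⟨m, ⟨e⟩⟩ := h
  exact PP.of_equiv e.symm.toRingEquiv (PP.frac m)

theorem PP.of_stable {K : Type*} [Field K] [Algebra ℂ K] (h : IsStablyRational K) : PP K := by
  obtain ⟨n, h⟩ := h
  have : Infinite K := Infinite.of_injective _ (algebraMap ℂ K).injective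
  exact PP.of_fracPoly n (PP.of_pure h)

end Final

/-- **Saltman: counter-example to the Noether problem over `ℂ`.** There exist `n` and a
finite subgroup `G` of `GLₙ(ℂ)`, acting on `ℂ(x₁,…,xₙ)` by `ℂ`-algebra automorphisms
through its linear action on the variables, whose fixed field is not stably rational over
`ℂ`; in particular it is not purely transcendental over `ℂ`. -/
theorem noether_problem_counterexample :
    ∃ (n : ℕ) (G : Subgroup (Matrix.GeneralLinearGroup (Fin n) ℂ)) (_ : Finite G)
      (ρ : G →* (CRatFunc n ≃ₐ[ℂ] CRatFunc n)),
      (∀ (g : G) (i : Fin n),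
        ρ g (algebraMap (MvPolynomial (Fin n) ℂ) (CRatFunc n) (X i)) =
          algebraMap (MvPolynomial (Fin n) ℂ) (CRatFunc n)
            (∑ j : Fin n, ((g : Matrix.GeneralLinearGroup (Fin n) ℂ) :
              Matrix (Fin n) (Fin n) ℂ) j i • X j)) ∧
      ¬ IsStablyRational (IntermediateField.fixedField ρ.range) ∧
      ¬ IsPurelyTranscendental (IntermediateField.fixedField ρ.range) := by
  refine ⟨12, GG, GG_finite, rho, ?_, fun h => not_PP_fix (PP.of_stable h),
    fun h => not_PP_fix (PP.of_pure h)⟩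
  intro g i
  rw [← polyAct_X]
  exact ratAct_alg (g : Matrix.GeneralLinearGroup (Fin 12) ℂ) (X i)
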